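/- Let C be an m×n Cauchon diagram. Then the matrix T^{(m,n)} produced by Launois' algorithm applied to C equals the path matrix M_C of the Cauchon graph G_C. -/

import Mathlib

universe u

/-- Quantum affine space data: a central unit `q` and units `t i j`
satisfying the quantum affine space commutation relations. -/
structure QMData (R : Type u) [Ring R] (m n : ℕ) where
  q : Rˣ
  t : Fin m → Fin n → Rˣ
  q_central : ∀ r : R, (q : R) * r = r * (q : R)
  row_rel : ∀ (i : Fin m) ⦃j j' : Fin n⦄, j < j' →
    (t i j : R) * (t i j' : R) = (q : R) * ((t i j' : R) * (t i j : R))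
  col_rel : ∀ ⦃i i' : Fin m⦄ (j : Fin n), i < i' →
    (t i j : R) * (t i' j : R) = (q : R) * ((t i' j : R) * (t i j : R))
  mixed_rel : ∀ ⦃i i' : Fin m⦄ ⦃j j' : Fin n⦄, i < i' → j ≠ j' →
    (t i j : R) * (t i' j' : R) = (t i' j' : R) * (t i j : R)

/-- `white i j = true` means the square `(i,j)` is white.  The Cauchon
condition: for every black square, either every square above it or every
square to its left is also black. -/
def IsCauchon {m n : ℕ} (white : Fin m → Fin n → Bool) : Prop :=
  ∀ i j, white i j = false →
    (∀ i' : Fin m, i' < i → white i' j = false) ∨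
    (∀ j' : Fin n, j' < j → white i j' = false)

/-- Vertices of the Cauchon graph: white squares, row vertices `r_i`,
column vertices `c_j`. -/
inductive CVertex (m n : ℕ) where
  | sq : Fin m → Fin n → CVertex m n
  | row : Fin m → CVertex m n
  | col : Fin n → CVertex m n
deriving DecidableEq

/-- Directed edges of the Cauchon graph. -/
inductive CEdge {m n : ℕ} (white : Fin m → Fin n → Bool) :
    CVertex m n → CVertex m n → Prop where
  | fromRow (i : Fin m) (k : Fin n) :
      white i k = true → (∀ k' : Fin n, k < k' → white i k' = false) →
      CEdge white (.row i) (.sq i k)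
  | toCol (i : Fin m) (j : Fin n) :
      white i j = true → (∀ i' : Fin m, i < i' → white i' j = false) →
      CEdge white (.sq i j) (.col j)
  | horiz (i : Fin m) (k j : Fin n) :
      j < k → white i k = true → white i j = true →
      (∀ j' : Fin n, j < j' → j' < k → white i j' = false) →
      CEdge white (.sq i k) (.sq i j)
  | vert (i i' : Fin m) (j : Fin n) :
      i < i' → white i j = true → white i' j = true →
      (∀ l : Fin m, i < l → l < i' → white l j = false) →
      CEdge white (.sq i j) (.sq i' j)

/-- The weight of an edge of the Cauchon graph (1 on non-edges). -/
def wt {R : Type u} {m n : ℕ} [Ring R] (D : QMData R m n) :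
    CVertex m n → CVertex m n → R
  | .row i, .sq i' k => if i = i' then (D.t i' k : R) else 1
  | .sq i k, .sq i' j =>
      if i = i' ∧ j < k then (↑((D.t i k)⁻¹) * ↑(D.t i j) : R) else 1
  | _, _ => 1

/-- A pair of vertices spans a horizontal edge (edges from `r_i` are
horizontal; edges between squares are horizontal iff the rows agree). -/
def Horiz {m n : ℕ} : CVertex m n → CVertex m n → Prop
  | .row _, _ => True
  | .sq i _, .sq i' _ => i = i'
  | _, _ => False

/-- `l` is (the list of vertices of) a directed path from `u` to `v`. -/
def IsPathFrom {m n : ℕ} (white : Fin m → Fin n → Bool) (u v : CVertex m n)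
    (l : List (CVertex m n)) : Prop :=
  l.Chain' (CEdge white) ∧ l.head? = some u ∧ l.getLast? = some v

/-- The list of (endpoint pairs of the) edges of a path. -/
def steps {m n : ℕ} (l : List (CVertex m n)) : List (CVertex m n × CVertex m n) :=
  l.zip l.tail

/-- The weight of a path: the ordered product of its edge weights. -/
def pathWeight {R : Type u} {m n : ℕ} [Ring R] (D : QMData R m n)
    (l : List (CVertex m n)) : R :=
  ((steps l).map fun p => wt D p.1 p.2).prod

/-- The number of inversions (length) of a permutation of `Fin k`. -/
def invCount {k : ℕ} (σ : Equiv.Perm (Fin k)) : ℕ :=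
  ((Finset.univ : Finset (Fin k × Fin k)).filter fun p => p.1 < p.2 ∧ σ p.2 < σ p.1).card

/-- The quantum determinant of a `k × k` matrix over a (noncommutative) ring. -/
def qdet {R : Type u} [Ring R] {k : ℕ} (q : Rˣ) (N : Matrix (Fin k) (Fin k) R) : R :=
  ∑ σ : Equiv.Perm (Fin k),
    (-(q : R)) ^ invCount σ * ((List.finRange k).map fun i => N i (σ i)).prod

/-- The path matrix: entry `(i,j)` is the sum of the weights of all directed
paths from `r_i` to `c_j` (zero when there are none). -/
noncomputable def pathMatrix {R : Type u} {m n : ℕ} [Ring R] (D : QMData R m n)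
    (white : Fin m → Fin n → Bool) : Matrix (Fin m) (Fin n) R :=
  Matrix.of fun i j =>
    ∑ᶠ p : {l : List (CVertex m n) // IsPathFrom white (.row i) (.col j) l},
      pathWeight D p.1

/-- An `(R_I, C_J)`-path system: paths `P ℓ : r_{i_ℓ} ⇒ c_{j_{σ ℓ}}`. -/
structure PathSys {m n : ℕ} (white : Fin m → Fin n → Bool) {k : ℕ}
    (ι : Fin k → Fin m) (κ : Fin k → Fin n) where
  σ : Equiv.Perm (Fin k)
  P : Fin k → List (CVertex m n)
  isPath : ∀ l : Fin k, IsPathFrom white (.row (ι l)) (.col (κ (σ l))) (P l)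

/-- A path system is vertex-disjoint if no two of its paths share a vertex. -/
def PathSys.VertexDisjoint {m n : ℕ} {white : Fin m → Fin n → Bool} {k : ℕ}
    {ι : Fin k → Fin m} {κ : Fin k → Fin n} (S : PathSys white ι κ) : Prop :=
  ∀ a b : Fin k, a ≠ b → ∀ x : CVertex m n, x ∈ S.P a → x ∈ S.P b → False

/-- The weight of a path system: the ordered product `w(P₁)⋯w(P_k)`. -/
def PathSys.weight {R : Type u} {m n : ℕ} [Ring R] (D : QMData R m n)
    {white : Fin m → Fin n → Bool} {k : ℕ} {ι : Fin k → Fin m} {κ : Fin k → Fin n}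
    (S : PathSys white ι κ) : R :=
  ((List.finRange k).map fun l => pathWeight D (S.P l)).prod

/-- The `q`-sign of a path system: `(-q) ^ ℓ(σ_P)`. -/
def PathSys.sgnq {R : Type u} {m n : ℕ} [Ring R] (D : QMData R m n)
    {white : Fin m → Fin n → Bool} {k : ℕ} {ι : Fin k → Fin m} {κ : Fin k → Fin n}
    (S : PathSys white ι κ) : R :=
  (-(D.q : R)) ^ invCount S.σ


/-- Launois' algorithm: `launoisStep D white p` is the matrix `T^{(s,t)}` where
`(s,t)` is the `p`-th step in the lexicographic order (0-indexed: `s = p / n`,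
`t = p % n`); step `0` is the initial matrix `T^{(1,1)}`. -/
def launoisStep {R : Type u} [Ring R] {m n : ℕ} (D : QMData R m n)
    (white : Fin m → Fin n → Bool) : ℕ → Matrix (Fin m) (Fin n) R
  | 0 => Matrix.of fun i j => if white i j then (D.t i j : R) else 0
  | p + 1 =>
    if h : (p + 1) / n < m ∧ (p + 1) % n < n then
      let s : Fin m := ⟨(p + 1) / n, h.1⟩
      let t : Fin n := ⟨(p + 1) % n, h.2⟩
      if white s t then
        Matrix.of fun i j =>
          if (i : ℕ) < (s : ℕ) ∧ (j : ℕ) < (t : ℕ) then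
            launoisStep D white p i j +
              launoisStep D white p i t * ↑((D.t s t)⁻¹) * launoisStep D white p s j
          else launoisStep D white p i j
      else launoisStep D white p
    else launoisStep D white p

section LaunoisPathMatrix

variable {R : Type u} [Ring R] {m n : ℕ}

/-- The entry `t i j` at a white square, and `0` at a black square. -/
def whiteEntry (D : QMData R m n) (white : Fin m → Fin n → Bool) (i : Fin m) (j : Fin n) : R :=
  if white i j then (D.t i j : R) else 0

/-- Closed form of the first `s` rows of Launois' algorithm once those rows have been processed
(and `0` in the remaining rows). -/
def rowClosed (D : QMData R m n) (white : Fin m → Fin n → Bool) : ℕ → Fin m → Fin n → R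
  | 0, _, _ => 0
  | s + 1, i, j =>
    if h : s < m then
      rowClosed D white s i j + (if i = ⟨s, h⟩ then whiteEntry D white ⟨s, h⟩ j else 0) +
        ∑ k : Fin n, if j < k ∧ white ⟨s, h⟩ k then
          rowClosed D white s i k * ↑((D.t ⟨s, h⟩ k)⁻¹) * whiteEntry D white ⟨s, h⟩ j else 0
    else rowClosed D white s i j

/-- Closed form of Launois' algorithm after processing the rows before `s` and the first `t`
squares of row `s`. -/
def partialClosed (D : QMData R m n) (white : Fin m → Fin n → Bool) (s t : ℕ)
    (i : Fin m) (j : Fin n) : R :=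
  if (i : ℕ) < s then
    if h : s < m then
      rowClosed D white s i j +
        ∑ k : Fin n, if (j < k ∧ white ⟨s, h⟩ k) ∧ (k : ℕ) < t then
          rowClosed D white s i k * ↑((D.t ⟨s, h⟩ k)⁻¹) * whiteEntry D white ⟨s, h⟩ j else 0
    else rowClosed D white s i j
  else whiteEntry D white i j

theorem rowClosed_eq_zero (D : QMData R m n) (white : Fin m → Fin n → Bool) (s : ℕ)
    (i : Fin m) (hi : s ≤ i) (j : Fin n) : rowClosed D white s i j = 0 := by
  induction s generalizing j with
  | zero => rfl
  | succ s ih =>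
    have hs : s < m := by omega
    have hne : i ≠ ⟨s, hs⟩ := by
      rintro rfl
      simp at hi
    simp [rowClosed, hs, hne, ih (by omega)]

theorem rowClosed_succ (D : QMData R m n) (white : Fin m → Fin n → Bool)
    (s i : Fin m) (j : Fin n) :
    rowClosed D white (s + 1) i j =
      rowClosed D white s i j + (if i = s then whiteEntry D white s j else 0) +
        ∑ k : Fin n, if j < k ∧ white s k then
          rowClosed D white s i k * ↑((D.t s k)⁻¹) * whiteEntry D white s j else 0 := by
  simp [rowClosed]

theorem partialClosed_row_end (D : QMData R m n) (white : Fin m → Fin n → Bool) (s : ℕ)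
    (hs : s < m) (i : Fin m) (j : Fin n) :
    partialClosed D white s n i j = partialClosed D white (s + 1) 0 i j := by
  rcases lt_trichotomy (i : ℕ) s with h | h | h
  · have hne : i ≠ ⟨s, hs⟩ := by
      rintro rfl
      simp at h
    simp [partialClosed, rowClosed, h, hs, hne, Nat.lt_succ_of_lt h]
  · subst h
    simp [partialClosed, rowClosed, rowClosed_eq_zero]
  · have h1 : ¬ (i : ℕ) < s := by omega
    have h2 : ¬ (i : ℕ) < s + 1 := by omega
    simp [partialClosed, h1, h2]

theorem partialClosed_current_column (D : QMData R m n) (white : Fin m → Fin n → Bool) (s : Fin m)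
    (t : Fin n) (i : Fin m) (hi : i < s) :
    partialClosed D white s t i t = rowClosed D white s i t := by
  have hi' : (i : ℕ) < s := hi
  have : ∀ k : Fin n, ¬ ((t < k ∧ white s k) ∧ k < t) := by
    rintro k ⟨⟨h, -⟩, h'⟩
    exact absurd h' h.asymm
  simp [partialClosed, hi', this]

theorem partialClosed_step (D : QMData R m n) (white : Fin m → Fin n → Bool) (s : Fin m)
    (t : Fin n) (i : Fin m) (j : Fin n) :
    partialClosed D white s (t + 1) i j =
      if white s t ∧ (i : ℕ) < s ∧ (j : ℕ) < t then
        partialClosed D white s t i j +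
          partialClosed D white s t i t * ↑((D.t s t)⁻¹) * partialClosed D white s t s j
      else partialClosed D white s t i j := by
  by_cases hi : (i : ℕ) < s
  · rw [partialClosed_current_column D white s t i hi]
    have hj : ∀ k : Fin n, k < t ↔ (k : ℕ) < t := fun k => Iff.rfl
    have hsum : ∀ g : Fin n → R,
        (∑ k : Fin n, if (j < k ∧ white s k) ∧ (k : ℕ) < t + 1 then g k else 0) =
          (∑ k : Fin n, if (j < k ∧ white s k) ∧ (k : ℕ) < t then g k else 0) +
            if j < t ∧ white s t then g t else 0 := by
      intro g
      have h1 : (if j < t ∧ white s t then g t else 0) =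
          ∑ k : Fin n, if k = t then (if j < k ∧ white s k then g k else 0) else 0 := by simp
      rw [h1, ← Finset.sum_add_distrib]
      refine Finset.sum_congr rfl fun k _ => ?_
      by_cases hk : k = t
      · subst hk
        simp
      · have hk' : (k : ℕ) < t + 1 ↔ (k : ℕ) < t := by
          have := Fin.val_ne_of_ne hk
          omega
        simp [hk, hk']
    have hL : ∀ t' : ℕ, partialClosed D white s t' i j = rowClosed D white s i j +
        ∑ k : Fin n, if (j < k ∧ white s k) ∧ (k : ℕ) < t' then
          rowClosed D white s i k * ↑((D.t s k)⁻¹) * whiteEntry D white s j else 0 := by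
      intro t'
      simp [partialClosed, hi]
    have hS : partialClosed D white s t s j = whiteEntry D white s j := by
      simp [partialClosed]
    rw [hL, hL, hS, hsum, ← add_assoc]
    by_cases hw : white s t <;> by_cases hjt : j < t
    · simp [hw, hi, hjt, (hj j).1 hjt]
    · simp [hw, hi, hjt, mt (hj j).2 hjt]
    · simp [hw]
    · simp [hw]
  · simp [partialClosed, hi]

theorem launoisStep_eq_partialClosed (D : QMData R m n) (white : Fin m → Fin n → Bool) (p : ℕ)
    (hp : p < m * n) (i : Fin m) (j : Fin n) :
    launoisStep D white p i j = partialClosed D white (p / n) (p % n + 1) i j := by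
  have hn : 0 < n := j.pos
  induction p generalizing i j with
  | zero => simp [launoisStep, partialClosed, whiteEntry]
  | succ p ih =>
    have hs : (p + 1) / n < m := (Nat.div_lt_iff_lt_mul hn).2 hp
    have ht : (p + 1) % n < n := Nat.mod_lt _ hn
    have ih' : ∀ i j, launoisStep D white p i j =
        partialClosed D white ((p + 1) / n) ((p + 1) % n) i j := by
      intro i j
      rw [ih (by omega) i j]
      by_cases hd : p % n + 1 = n
      · have hdvd : n ∣ p + 1 := by
          refine Nat.dvd_of_mod_eq_zero ?_
          rw [← Nat.mod_add_mod, hd, Nat.mod_self]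
        rw [Nat.succ_div_of_dvd hdvd, Nat.mod_eq_zero_of_dvd hdvd, hd]
        refine partialClosed_row_end D white _ ?_ i j
        exact (Nat.div_lt_iff_lt_mul hn).2 (by omega)
      · have hlt : p % n + 1 < n := lt_of_le_of_ne (Nat.mod_lt p hn) hd
        have hmod : (p + 1) % n = p % n + 1 := by
          rw [← Nat.mod_add_mod, Nat.mod_eq_of_lt hlt]
        have hdvd : ¬ n ∣ p + 1 := fun h => by
          rw [Nat.mod_eq_zero_of_dvd h] at hmod
          omega
        rw [Nat.succ_div_of_not_dvd hdvd, hmod]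
    have key := partialClosed_step D white ⟨_, hs⟩ ⟨_, ht⟩ i j
    simp only at key
    rw [key]
    simp only [launoisStep, hs, ht, and_self, dite_true]
    split_ifs with h1 h2 h2
    · simp only [Matrix.of_apply]
      rw [if_pos h2.2, ih', ih', ih']
    · simp only [Matrix.of_apply]
      rw [if_neg (fun h => h2 ⟨h1, h⟩), ih']
    · exact absurd h2.1 h1
    · exact ih' i j

theorem launoisStep_final (D : QMData R m n) (white : Fin m → Fin n → Bool)
    (i : Fin m) (j : Fin n) :
    launoisStep D white (m * n - 1) i j = rowClosed D white m i j := by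
  have hn : 0 < n := j.pos
  have hm : 0 < m := i.pos
  have hmn : 0 < m * n := Nat.mul_pos hm hn
  obtain ⟨m', rfl⟩ : ∃ m', m = m' + 1 := ⟨m - 1, by omega⟩
  obtain ⟨n', rfl⟩ : ∃ n', n = n' + 1 := ⟨n - 1, by omega⟩
  have hp : (m' + 1) * (n' + 1) - 1 = n' + (n' + 1) * m' := by
    have : (m' + 1) * (n' + 1) = n' + (n' + 1) * m' + 1 := by ring
    omega
  rw [launoisStep_eq_partialClosed D white _ (by omega), hp, Nat.add_mul_div_left _ _ hn,
    Nat.add_mul_mod_self_left, Nat.div_eq_of_lt (Nat.lt_succ_self n'),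
    Nat.mod_eq_of_lt (Nat.lt_succ_self n'), zero_add,
    partialClosed_row_end D white m' (Nat.lt_succ_self m'), partialClosed, if_pos i.isLt,
    dif_neg (lt_irrefl _)]

/-- The set of directed paths from `r_i` to the vertex `v`. -/
def pathsTo (white : Fin m → Fin n → Bool) (i : Fin m) (v : CVertex m n) :
    Set (List (CVertex m n)) :=
  {l | IsPathFrom white (.row i) v l}

/-- The sum of the weights of all directed paths from `r_i` to the vertex `v`. -/
noncomputable def pathSum (D : QMData R m n) (white : Fin m → Fin n → Bool) (i : Fin m)
    (v : CVertex m n) : R :=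
  ∑ᶠ l ∈ pathsTo white i v, pathWeight D l

theorem steps_append_singleton (l : List (CVertex m n)) (w v : CVertex m n)
    (h : l.getLast? = some w) : steps (l ++ [v]) = steps l ++ [(w, v)] := by
  obtain ⟨l', rfl⟩ := List.getLast?_eq_some_iff.1 h
  clear h
  induction l' with
  | nil => simp [steps]
  | cons a l' ih => cases l' <;> simp_all [steps]

theorem pathWeight_append_singleton (D : QMData R m n) (l : List (CVertex m n))
    (w v : CVertex m n) (h : l.getLast? = some w) :
    pathWeight D (l ++ [v]) = pathWeight D l * wt D w v := by
  simp [pathWeight, steps_append_singleton l w v h]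

theorem pathsTo_row (white : Fin m → Fin n → Bool) (i k : Fin m) :
    pathsTo white i (.row k) = if i = k then {[.row i]} else ∅ := by
  ext l
  constructor
  · rintro ⟨hc, hh, hl⟩
    obtain ⟨l', rfl⟩ := List.getLast?_eq_some_iff.1 hl
    rcases List.eq_nil_or_concat l' with rfl | ⟨l'', w, rfl⟩
    · simp at hh
      simp [hh]
    · have : CEdge white w (.row k) := by
        have := (List.isChain_append.1 hc).2.2
        exact this w (by simp) _ (by simp)
      cases this
  · split_ifs with h
    · rintro rfl
      subst h
      exact ⟨List.isChain_singleton _, rfl, rfl⟩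
    · exact False.elim

theorem pathsTo_eq_biUnion (white : Fin m → Fin n → Bool) (i : Fin m) (v : CVertex m n)
    (hv : ∀ k, v ≠ .row k) :
    pathsTo white i v =
      ⋃ w ∈ {w | CEdge white w v}, (fun l => l ++ [v]) '' pathsTo white i w := by
  ext l
  simp only [Set.mem_iUnion, Set.mem_image, Set.mem_ofPred_eq, exists_prop]
  constructor
  · rintro ⟨hc, hh, hl⟩
    obtain ⟨l', rfl⟩ := List.getLast?_eq_some_iff.1 hl
    rcases List.eq_nil_or_concat l' with rfl | ⟨l'', w, rfl⟩
    · simp at hh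
      exact absurd hh (hv i)
    · obtain ⟨h1, -, h3⟩ := List.isChain_append.1 hc
      refine ⟨w, h3 w (by simp) _ (by simp), _, ⟨h1, ?_, by simp⟩, rfl⟩
      cases l'' <;> simpa using hh
  · rintro ⟨w, hw, l, ⟨hc, hh, hl⟩, rfl⟩
    refine ⟨List.isChain_append.2 ⟨hc, by simp, ?_⟩, ?_, by simp⟩
    · intro x hx y hy
      simp_all
    · cases l <;> simp_all

/-- A rank on the vertices of the Cauchon graph, increasing along edges. -/
def vertexRank : CVertex m n → ℕ
  | .row _ => 0
  | .sq i j => 1 + i + (n - j)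
  | .col _ => 2 + m + n

theorem vertexRank_lt {white : Fin m → Fin n → Bool} {w v : CVertex m n}
    (h : CEdge white w v) : vertexRank w < vertexRank v := by
  cases h <;> simp only [vertexRank] <;> omega

instance : Finite (CVertex m n) :=
  Finite.of_injective (β := (Fin m × Fin n) ⊕ Fin m ⊕ Fin n)
    (fun
      | .sq i j => .inl (i, j)
      | .row i => .inr (.inl i)
      | .col j => .inr (.inr j))
    (by rintro (_ | _ | _) (_ | _ | _) <;> simp)

theorem finite_pathsTo (white : Fin m → Fin n → Bool) (i : Fin m) (v : CVertex m n) :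
    (pathsTo white i v).Finite := by
  induction h : vertexRank v using Nat.strong_induction_on generalizing v with
  | _ r ih =>
    by_cases hv : ∃ k, v = .row k
    · obtain ⟨k, rfl⟩ := hv
      rw [pathsTo_row]
      split_ifs <;> simp
    · rw [pathsTo_eq_biUnion white i v (not_exists.1 hv)]
      refine (Set.toFinite _).biUnion fun w hw => Set.Finite.image _ ?_
      exact ih _ (h ▸ vertexRank_lt hw) w rfl

theorem pathSum_row (D : QMData R m n) (white : Fin m → Fin n → Bool) (i k : Fin m) :
    pathSum D white i (.row k) = if i = k then 1 else 0 := by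
  rw [pathSum, pathsTo_row]
  split_ifs
  · rw [finsum_mem_singleton]
    simp [pathWeight, steps]
  · exact finsum_mem_empty

theorem pathSum_eq_finsum (D : QMData R m n) (white : Fin m → Fin n → Bool) (i : Fin m)
    (v : CVertex m n) (hv : ∀ k, v ≠ .row k) :
    pathSum D white i v = ∑ᶠ w ∈ {w | CEdge white w v}, pathSum D white i w * wt D w v := by
  rw [pathSum, pathsTo_eq_biUnion white i v hv, finsum_mem_biUnion _ (Set.toFinite _)
    fun w _ => (finite_pathsTo white i w).image _]
  · refine finsum_mem_congr rfl fun w _ => ?_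
    rw [finsum_mem_image (List.append_left_injective [v]).injOn, pathSum,
      finsum_mem_mul' _ _ (finite_pathsTo white i w)]
    exact finsum_mem_congr rfl fun l hl => pathWeight_append_singleton D l w v hl.2.2
  · intro w _ w' _ hww'
    refine Set.disjoint_left.2 ?_
    rintro _ ⟨l, hl, rfl⟩ ⟨l', hl', h⟩
    have : l' = l := List.append_left_injective [v] h
    subst this
    exact hww' (Option.some_injective _ (hl.2.2.symm.trans hl'.2.2))

/-- The white squares of column `j` that are lowest among the rows above `s`
(there is at most one). -/
def lowestAbove (white : Fin m → Fin n → Bool) (s : ℕ) (j : Fin n) : Set (CVertex m n) :=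
  {w | ∃ i : Fin m, w = .sq i j ∧ (i : ℕ) < s ∧ white i j = true ∧
    ∀ l : Fin m, i < l → (l : ℕ) < s → white l j = false}

theorem lowestAbove_zero (white : Fin m → Fin n → Bool) (j : Fin n) :
    lowestAbove white 0 j = ∅ := by
  simp [lowestAbove]

theorem lowestAbove_succ_of_white (white : Fin m → Fin n → Bool) (s : Fin m) (j : Fin n)
    (h : white s j = true) : lowestAbove white (s + 1) j = {.sq s j} := by
  ext w
  constructor
  · rintro ⟨i, rfl, hi, -, hl⟩
    rcases Nat.lt_succ_iff_lt_or_eq.1 hi with hi | hi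
    · have := hl s hi (Nat.lt_succ_self _)
      simp [h] at this
    · rw [Fin.ext hi]
      rfl
  · rintro rfl
    exact ⟨s, rfl, Nat.lt_succ_self _, h, fun l h1 h2 => absurd h1 (by simp; omega)⟩

theorem lowestAbove_succ_of_black (white : Fin m → Fin n → Bool) (s : Fin m) (j : Fin n)
    (h : white s j = false) : lowestAbove white (s + 1) j = lowestAbove white s j := by
  ext w
  constructor
  · rintro ⟨i, rfl, hi, hw, hl⟩
    refine ⟨i, rfl, ?_, hw, fun l h1 h2 => hl l h1 (by omega)⟩
    rcases Nat.lt_succ_iff_lt_or_eq.1 hi with hi | hi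
    · exact hi
    · rw [Fin.ext hi, h] at hw
      cases hw
  · rintro ⟨i, rfl, hi, hw, hl⟩
    refine ⟨i, rfl, by omega, hw, fun l h1 h2 => ?_⟩
    rcases Nat.lt_succ_iff_lt_or_eq.1 h2 with h2 | h2
    · exact hl l h1 h2
    · rw [Fin.ext h2, h]

/-- The horizontal predecessors of the white square `(s, j)` in the Cauchon graph. -/
def horizPred (white : Fin m → Fin n → Bool) (s : Fin m) (j : Fin n) : Set (CVertex m n) :=
  {w | (w = .row s ∧ ∀ k, j < k → white s k = false) ∨
    ∃ k, w = .sq s k ∧ j < k ∧ white s k = true ∧ ∀ l, j < l → l < k → white s l = false}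

theorem pred_sq (white : Fin m → Fin n → Bool) (s : Fin m) (j : Fin n) (h : white s j = true) :
    {w | CEdge white w (.sq s j)} = lowestAbove white s j ∪ horizPred white s j := by
  ext w
  constructor
  · rintro (⟨_, _, _, hk⟩ | _ | ⟨_, k, _, h1, h2, -, h3⟩ | ⟨i, _, _, h1, h2, -, h3⟩)
    · exact Or.inr (Or.inl ⟨rfl, hk⟩)
    · exact Or.inr (Or.inr ⟨k, rfl, h1, h2, h3⟩)
    · exact Or.inl ⟨i, rfl, h1, h2, h3⟩
  · rintro (⟨i, rfl, h1, h2, h3⟩ | ⟨rfl, hk⟩ | ⟨k, rfl, h1, h2, h3⟩)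
    · exact .vert i s j h1 h2 h h3
    · exact .fromRow s j h hk
    · exact .horiz s k j h1 h2 h h3

theorem pred_col (white : Fin m → Fin n → Bool) (j : Fin n) :
    {w | CEdge white w (.col j)} = lowestAbove white m j := by
  ext w
  constructor
  · rintro (_ | ⟨i, _, h1, h2⟩)
    exact ⟨i, rfl, i.isLt, h1, fun l hl _ => h2 l hl⟩
  · rintro ⟨i, rfl, -, h1, h2⟩
    exact .toCol i j h1 fun l hl => h2 l hl l.isLt

theorem disjoint_lowestAbove_horizPred (white : Fin m → Fin n → Bool) (s : Fin m) (j : Fin n) :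
    Disjoint (lowestAbove white s j) (horizPred white s j) := by
  refine Set.disjoint_left.2 ?_
  rintro _ ⟨i, rfl, hi, -⟩ (⟨h, -⟩ | ⟨k, h, -⟩)
  · cases h
  · cases h
    exact lt_irrefl _ hi

theorem finsum_lowestAbove_mul_wt_sq (D : QMData R m n) (white : Fin m → Fin n → Bool)
    (f : CVertex m n → R) (s : Fin m) (j : Fin n) :
    ∑ᶠ w ∈ lowestAbove white s j, f w * wt D w (.sq s j) = ∑ᶠ w ∈ lowestAbove white s j, f w := by
  refine finsum_mem_congr rfl ?_
  rintro _ ⟨i, rfl, -⟩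
  simp [wt]

theorem finsum_lowestAbove_mul_wt_col (D : QMData R m n) (white : Fin m → Fin n → Bool)
    (f : CVertex m n → R) (s : ℕ) (j : Fin n) :
    ∑ᶠ w ∈ lowestAbove white s j, f w * wt D w (.col j) = ∑ᶠ w ∈ lowestAbove white s j, f w := by
  refine finsum_mem_congr rfl ?_
  rintro _ ⟨i, rfl, -⟩
  simp [wt]

/-- Splitting a sum over the white squares to the right of `j` at the nearest one. -/
theorem sum_right_eq (white : Fin n → Bool) (g : Fin n → R) {j k : Fin n} (hjk : j < k)
    (hk : white k = true) (hl : ∀ l, j < l → l < k → white l = false) :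
    (∑ l, if j < l ∧ white l then g l else 0) =
      g k + ∑ l, if k < l ∧ white l then g l else 0 := by
  have h1 : g k = ∑ l, if l = k then g l else 0 := by simp
  rw [h1, ← Finset.sum_add_distrib]
  refine Finset.sum_congr rfl fun l _ => ?_
  rcases lt_trichotomy l k with h | rfl | h
  · by_cases hj : j < l
    · simp [hl l hj h, h.ne]
    · simp [hj, h.ne, h.le]
  · simp [hjk, hk]
  · simp [hjk.trans h, h, h.ne']

theorem pathSum_sq (D : QMData R m n) (white : Fin m → Fin n → Bool) (i s : Fin m)
    (hE : ∀ j, ∑ᶠ w ∈ lowestAbove white s j, pathSum D white i w = rowClosed D white s i j)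
    (j : Fin n) (h : white s j = true) :
    pathSum D white i (.sq s j) = rowClosed D white (s + 1) i j := by
  induction hr : n - (j : ℕ) using Nat.strong_induction_on generalizing j with
  | _ r ih =>
    rw [pathSum_eq_finsum D white i _ (by simp), pred_sq white s j h,
      finsum_mem_union (disjoint_lowestAbove_horizPred white s j) (Set.toFinite _)
        (Set.toFinite _), finsum_lowestAbove_mul_wt_sq, hE, rowClosed_succ, add_assoc]
    congr 1
    by_cases hright : ∃ k, j < k ∧ white s k = true ∧ ∀ l, j < l → l < k → white s l = false
    · obtain ⟨k, hjk, hk, hl⟩ := hright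
      have hset : horizPred white s j = {.sq s k} := by
        ext w
        constructor
        · rintro (⟨-, h'⟩ | ⟨k', rfl, h1, h2, h3⟩)
          · simp [h' k hjk] at hk
          · have : k' = k := by
              rcases lt_trichotomy k' k with h' | h' | h'
              · simp [hl k' h1 h'] at h2
              · exact h'
              · simp [h3 k hjk h'] at hk
            rw [this]
            rfl
        · rintro rfl
          exact Or.inr ⟨k, rfl, hjk, hk, hl⟩
      rw [hset, finsum_mem_singleton, ih (n - k) (by have : (j : ℕ) < k := hjk; omega) k hk rfl,
        rowClosed_succ, sum_right_eq (white s) _ hjk hk hl]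
      have hwt : wt D (.sq s k) (.sq s j) = ↑((D.t s k)⁻¹) * (D.t s j : R) := by simp [wt, hjk]
      rw [hwt]
      simp only [whiteEntry, h, hk, if_true, add_mul, Finset.sum_mul, ite_mul, zero_mul]
      simp only [mul_assoc, Units.mul_inv_cancel_left]
      abel
    · have hblack : ∀ k, j < k → white s k = false := by
        by_contra! hne
        have hne' : (Finset.univ.filter fun k => j < k ∧ white s k = true).Nonempty := by
          obtain ⟨k, hk⟩ := hne
          exact ⟨k, by simpa using hk⟩
        obtain ⟨k, hk, hmin⟩ := Finset.exists_minimal hne'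
        simp only [Finset.mem_filter, Finset.mem_univ, true_and] at hk hmin
        refine hright ⟨k, hk.1, hk.2, fun l h1 h2 => ?_⟩
        by_contra hl
        exact absurd (hmin ⟨h1, by simpa using hl⟩ h2.le) h2.not_ge
      have hset : horizPred white s j = {.row s} := by
        ext w
        constructor
        · rintro (⟨rfl, -⟩ | ⟨k, -, hk⟩)
          · rfl
          · exact absurd ⟨k, hk⟩ hright
        · rintro rfl
          exact Or.inl ⟨rfl, hblack⟩
      have hzero : ∀ k, ¬ (j < k ∧ white s k = true) := fun k hk => by
        simp [hblack k hk.1] at hk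
      rw [hset, finsum_mem_singleton, pathSum_row]
      simp [hzero, whiteEntry, h, wt]

theorem finsum_lowestAbove (D : QMData R m n) (white : Fin m → Fin n → Bool) (i : Fin m)
    (s : ℕ) (hs : s ≤ m) (j : Fin n) :
    ∑ᶠ w ∈ lowestAbove white s j, pathSum D white i w = rowClosed D white s i j := by
  induction s generalizing j with
  | zero =>
    rw [lowestAbove_zero, finsum_mem_empty]
    rfl
  | succ s ih =>
    specialize ih (by omega)
    lift s to Fin m using hs
    by_cases h : white s j = true
    · rw [lowestAbove_succ_of_white white s j h, finsum_mem_singleton, pathSum_sq D white i s ih j h]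
    · have h' : white s j = false := by simpa using h
      rw [lowestAbove_succ_of_black white s j h', ih, rowClosed_succ]
      simp [whiteEntry, h']

theorem pathMatrix_eq_rowClosed (D : QMData R m n) (white : Fin m → Fin n → Bool)
    (i : Fin m) (j : Fin n) : pathMatrix D white i j = rowClosed D white m i j := by
  rw [← finsum_lowestAbove D white i m le_rfl j, ← finsum_lowestAbove_mul_wt_col D, ← pred_col,
    ← pathSum_eq_finsum D white i _ (by simp)]
  exact finsum_set_coe_eq_finsum_mem (pathsTo white i (.col j)) (f := pathWeight D)

end LaunoisPathMatrix

/-- the final matrix `T^{(m,n)}` of Launois' algorithm is the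
path matrix `M_C`. -/
theorem launois_eq_pathMatrix {R : Type u} [Ring R] {m n : ℕ} (D : QMData R m n)
    (white : Fin m → Fin n → Bool) (hC : IsCauchon white) :
    launoisStep D white (m * n - 1) = pathMatrix D white := by
  ext i j
  rw [launoisStep_final, pathMatrix_eq_rowClosed]
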